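/- The 6-state 2-symbol Turing machine M with transition table δ(A,0)=(1,R,B), δ(A,1)=(0,L,D), δ(B,0)=(1,R,C), δ(B,1)=(0,R,F), δ(C,0)=(1,L,C), δ(C,1)=(1,L,A), δ(D,0)=(0,L,E), δ(D,1)=(1,R,H), δ(E,0)=(1,L,A), δ(E,1)=(0,R,B), δ(F,0)=(0,R,C), δ(F,1)=(0,R,E), started in state A on the all-blank tape, eventually halts, and its number of steps s(M) satisfies s(M) > 38·10^21131 while the number of non-blank cells σ(M) on its final tape satisfies σ(M) > 31·10^10565. -/

import Mathlib

/-- Move direction of the tape head. -/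
inductive Dir : Type
  | L
  | R

/-- The head displacement of a direction. -/
def Dir.move : Dir → ℤ
  | Dir.L => -1
  | Dir.R => 1

/-- A Turing machine with `n` states and `k` symbols, in Rado's busy beaver model.
States are `Fin n` (state `A` is `0`, `B` is `1`, ...), symbols are `Fin k` with `0`
the blank symbol. A transition yields the written symbol, the move direction and the
next state, where `none` denotes the halting state `H`. -/
abbrev Machine (n k : ℕ) : Type :=
  Fin n → Fin k → Fin k × Dir × Option (Fin n)

/-- A configuration: current state (`none` = halted), head position, tape. -/
structure Cfg (n k : ℕ) where
  state : Option (Fin n)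
  pos : ℤ
  tape : ℤ → Fin k

/-- One computation step (halted configurations are fixed). -/
def step {n k : ℕ} (M : Machine n k) (c : Cfg n k) : Cfg n k :=
  match c.state with
  | none => c
  | some q =>
      { state := (M q (c.tape c.pos)).2.2
        pos := c.pos + (M q (c.tape c.pos)).2.1.move
        tape := Function.update c.tape c.pos (M q (c.tape c.pos)).1 }

/-- The initial configuration: state `A`, head at cell `0`, all-blank tape. -/
def init (n k : ℕ) [NeZero k] : Cfg n k :=
  { state := if h : 0 < n then some ⟨0, h⟩ else none
    pos := 0
    tape := fun _ => 0 }

/-- `HaltsIn M c t`: started from `c`, the machine `M` halts after exactly `t` steps. -/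
def HaltsIn {n k : ℕ} (M : Machine n k) (c : Cfg n k) (t : ℕ) : Prop :=
  ((step M)^[t] c).state = none ∧ ∀ i < t, ((step M)^[i] c).state ≠ none

/-- The number of non-blank cells of a configuration. -/
noncomputable def sigmaCount {n k : ℕ} [NeZero k] (c : Cfg n k) : ℕ :=
  Set.ncard {i : ℤ | c.tape i ≠ 0}

/-- Kropitz's 6-state 2-symbol machine
(states `A,B,C,D,E,F` are `0,1,2,3,4,5`; `none` is the halting state `H`). -/
def M : Machine 6 2 :=
  ![![(1, Dir.R, some 1), (0, Dir.L, some 3)],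
    ![(1, Dir.R, some 2), (0, Dir.R, some 5)],
    ![(1, Dir.L, some 2), (1, Dir.L, some 0)],
    ![(0, Dir.L, some 4), (1, Dir.R, none)],
    ![(1, Dir.L, some 0), (0, Dir.R, some 1)],
    ![(0, Dir.R, some 2), (0, Dir.R, some 4)]]

/-- The configuration `C(n,k)` based at cell `p`: the tape reads (all other cells blank)
one cell `1` at `p`, then `n` blank cells, then `3k+2` cells `1` (a separator `1`
followed by `3k+1` cells `1`), the machine being in state `C` scanning the leftmost of
these `3k+1` cells, i.e. cell `p+n+2`. -/
def Cf (n k : ℕ) (p : ℤ) : Cfg 6 2 :=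
  { state := some 2
    pos := p + n + 2
    tape := fun i => if i = p ∨ (p + n + 1 ≤ i ∧ i ≤ p + n + 2 + 3 * k) then 1 else 0 }

open Stream' (cons const cons_append_stream nil_append_stream)

/-- The blank half-tape. -/
def blanks : Stream' (Fin 2) := const 0

/-- `block x j S` is the half-tape starting with `j` cells `x` and continuing as `S`. -/
def block (x : Fin 2) (j : ℕ) (S : Stream' (Fin 2)) : Stream' (Fin 2) :=
  (cons x)^[j] S

/-- A state together with the half-tape strictly left of the head (read leftwards) and the
half-tape starting at the head (read rightwards). -/
abbrev Snapshot : Type := Option (Fin 6) × Stream' (Fin 2) × Stream' (Fin 2)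

/-- The configuration described by a snapshot when the head is at `p`. -/
def Snapshot.toCfg (s : Snapshot) (p : ℤ) : Cfg 6 2 where
  state := s.1
  pos := p
  tape := fun i => if p ≤ i then s.2.2.get (i - p).toNat else s.2.1.get (p - 1 - i).toNat

/-- `Run t s s'`: the machine goes from `s` to `s'` in `t` steps, up to the head position. -/
def Run (t : ℕ) (s s' : Snapshot) : Prop :=
  ∀ p, ∃ p', (step M)^[t] (s.toCfg p) = s'.toCfg p'

namespace Run

theorem refl (s : Snapshot) : Run 0 s s := fun p => ⟨p, rfl⟩

theorem trans {a b : ℕ} {s s' s'' : Snapshot} (h : Run a s s') (h' : Run b s' s'') :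
    Run (a + b) s s'' := by
  intro p
  obtain ⟨p', hp⟩ := h p
  obtain ⟨p'', hp'⟩ := h' p'
  exact ⟨p'', by rw [Nat.add_comm, Function.iterate_add_apply, hp, hp']⟩

theorem cast {a b : ℕ} {s s' : Snapshot} (h : Run a s s') (hab : a = b) : Run b s s' :=
  hab ▸ h

theorem right {q : Fin 6} {x w : Fin 2} {q' : Option (Fin 6)} (h : M q x = (w, Dir.R, q'))
    (L R : Stream' (Fin 2)) : Run 1 (some q, L, cons x R) (q', cons w L, R) := by
  intro p
  refine ⟨p + 1, ?_⟩
  have hx : (Snapshot.toCfg (some q, L, cons x R) p).tape p = x := by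
    simp [Snapshot.toCfg]
  simp only [Function.iterate_one, step]
  change Cfg.mk (M q ((Snapshot.toCfg (some q, L, cons x R) p).tape p)).2.2 _ _ = _
  simp only [show (Snapshot.toCfg (some q, L, cons x R) p).pos = p from rfl, hx, h, Dir.move]
  simp only [Snapshot.toCfg, Cfg.mk.injEq, true_and]
  funext i
  rcases lt_trichotomy i p with hi | rfl | hi
  · obtain ⟨d, rfl⟩ : ∃ d : ℕ, i = p - 1 - d := ⟨(p - 1 - i).toNat, by omega⟩
    rw [Function.update_of_ne hi.ne, if_neg (by omega), if_neg (by omega),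
      show (p - 1 - (p - 1 - (d : ℤ))).toNat = d by omega,
      show (p + 1 - 1 - (p - 1 - (d : ℤ))).toNat = d + 1 by omega]
    rfl
  · rw [Function.update_self, if_neg (by omega), show (i + 1 - 1 - i).toNat = 0 by omega]
    rfl
  · obtain ⟨d, rfl⟩ : ∃ d : ℕ, i = p + 1 + d := ⟨(i - p - 1).toNat, by omega⟩
    rw [Function.update_of_ne hi.ne', if_pos (by omega), if_pos (by omega),
      show (p + 1 + (d : ℤ) - p).toNat = d + 1 by omega,
      show (p + 1 + (d : ℤ) - (p + 1)).toNat = d by omega]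
    rfl

theorem left {q : Fin 6} {x w : Fin 2} {q' : Option (Fin 6)} (h : M q x = (w, Dir.L, q'))
    (y : Fin 2) (L R : Stream' (Fin 2)) :
    Run 1 (some q, cons y L, cons x R) (q', L, cons y (cons w R)) := by
  intro p
  refine ⟨p - 1, ?_⟩
  have hx : (Snapshot.toCfg (some q, cons y L, cons x R) p).tape p = x := by
    simp [Snapshot.toCfg]
  simp only [Function.iterate_one, step]
  change Cfg.mk (M q ((Snapshot.toCfg (some q, cons y L, cons x R) p).tape p)).2.2 _ _ = _
  simp only [show (Snapshot.toCfg (some q, cons y L, cons x R) p).pos = p from rfl, hx, h,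
    Dir.move]
  simp only [Snapshot.toCfg, Cfg.mk.injEq, true_and]
  refine ⟨by omega, ?_⟩
  funext i
  rcases lt_trichotomy i p with hi | rfl | hi
  · rw [Function.update_of_ne hi.ne, if_neg (by omega)]
    obtain rfl | hi' := eq_or_ne i (p - 1)
    · rw [if_pos le_rfl, show (p - 1 - (p - 1)).toNat = 0 by omega]
      rfl
    · obtain ⟨d, rfl⟩ : ∃ d : ℕ, i = p - 2 - d := ⟨(p - 2 - i).toNat, by omega⟩
      rw [if_neg (by omega), show (p - 1 - (p - 2 - (d : ℤ))).toNat = d + 1 by omega,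
        show (p - 1 - 1 - (p - 2 - (d : ℤ))).toNat = d by omega]
      rfl
  · rw [Function.update_self, if_pos (by omega), show (i - (i - 1)).toNat = 1 by omega]
    rfl
  · obtain ⟨d, rfl⟩ : ∃ d : ℕ, i = p + 1 + d := ⟨(i - p - 1).toNat, by omega⟩
    rw [Function.update_of_ne hi.ne', if_pos (by omega), if_pos (by omega),
      show (p + 1 + (d : ℤ) - p).toNat = d + 1 by omega,
      show (p + 1 + (d : ℤ) - (p - 1)).toNat = d + 2 by omega]
    rfl

end Run

theorem cons_blanks : cons 0 blanks = blanks := (Stream'.const_eq 0).symm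

theorem block_zero (x : Fin 2) (S : Stream' (Fin 2)) : block x 0 S = S := rfl

theorem block_succ (x : Fin 2) (j : ℕ) (S : Stream' (Fin 2)) :
    block x (j + 1) S = cons x (block x j S) := Function.iterate_succ_apply' _ _ _

theorem block_block (x : Fin 2) (i j : ℕ) (S : Stream' (Fin 2)) :
    block x i (block x j S) = block x (i + j) S := (Function.iterate_add_apply _ _ _ _).symm

theorem block_cons (x : Fin 2) (j : ℕ) (S : Stream' (Fin 2)) :
    block x j (cons x S) = block x (j + 1) S := rfl

/-- One step on finite windows of the two half-tapes; `none` if the head leaves the windows. -/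
def windowStep : Option (Fin 6) × List (Fin 2) × List (Fin 2) →
    Option (Option (Fin 6) × List (Fin 2) × List (Fin 2))
  | (some q, l, x :: r) =>
    match M q x, l with
    | (w, Dir.R, q'), l => some (q', w :: l, r)
    | (w, Dir.L, q'), y :: l => some (q', l, y :: w :: r)
    | (_, Dir.L, _), [] => none
  | _ => none

/-- Iterated `windowStep`. -/
def windowRun : ℕ → Option (Fin 6) × List (Fin 2) × List (Fin 2) →
    Option (Option (Fin 6) × List (Fin 2) × List (Fin 2))
  | 0, s => some s
  | t + 1, s => (windowStep s).bind (windowRun t)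

theorem Run.of_windowStep {q q' : Option (Fin 6)} {l r l' r' : List (Fin 2)}
    (h : windowStep (q, l, r) = some (q', l', r')) (L R : Stream' (Fin 2)) :
    Run 1 (q, l ++ₛ L, r ++ₛ R) (q', l' ++ₛ L, r' ++ₛ R) := by
  unfold windowStep at h
  split at h
  · rename_i q₀ l₀ x r₀ heq
    obtain ⟨rfl, rfl, rfl⟩ : q = some q₀ ∧ l = l₀ ∧ r = x :: r₀ := by simpa using heq
    split at h
    · rename_i hM
      obtain ⟨rfl, rfl, rfl⟩ := by simpa using h
      exact Run.right hM _ _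
    · rename_i hM
      obtain ⟨rfl, rfl, rfl⟩ := by simpa using h
      exact Run.left hM _ _ _
    · simp at h
  · simp at h

theorem Run.of_windowRun {t : ℕ} {q q' : Option (Fin 6)} {l r l' r' : List (Fin 2)}
    (h : windowRun t (q, l, r) = some (q', l', r')) (L R : Stream' (Fin 2)) :
    Run t (q, l ++ₛ L, r ++ₛ R) (q', l' ++ₛ L, r' ++ₛ R) := by
  induction t generalizing q l r with
  | zero =>
    obtain ⟨rfl, rfl, rfl⟩ := by simpa [windowRun] using h
    exact Run.refl _
  | succ t ih =>
    obtain ⟨⟨q₁, l₁, r₁⟩, h₁, h₂⟩ := Option.bind_eq_some_iff.1 h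
    exact ((Run.of_windowStep h₁ L R).trans (ih h₂)).cast (Nat.add_comm 1 t)

/-- The right-moving sweep: `F`, `E`, `B` in turn erase three cells `1`. -/
theorem Run.sweep_right {q : Option (Fin 6)}
    (hq : windowRun 3 (q, [], [1, 1, 1]) = some (q, [0, 0, 0], [])) (j : ℕ)
    (L R : Stream' (Fin 2)) :
    Run (3 * j) (q, L, block 1 (3 * j) R) (q, block 0 (3 * j) L, R) := by
  induction j generalizing L with
  | zero => exact Run.refl _
  | succ j ih =>
    have h := Run.of_windowRun hq L (block 1 (3 * j) R)
    simp only [cons_append_stream, nil_append_stream] at h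
    have h' := h.trans (ih _)
    simp only [block_cons] at h'
    simp only [Nat.mul_succ, block_succ 1 (3 * j + _), block_succ 1 (3 * j)]
    exact h'.cast (Nat.add_comm _ _)

/-- The left-moving sweep of state `C` fills a block of blank cells with `1`. -/
theorem Run.sweep_left (j : ℕ) (L R : Stream' (Fin 2)) :
    Run j (some 2, block 0 j L, cons 0 R) (some 2, L, cons 0 (block 1 j R)) := by
  induction j generalizing R with
  | zero => exact Run.refl _
  | succ j ih =>
    rw [block_succ]
    exact ((Run.left rfl 0 _ R).trans (ih (cons 1 R))).cast (Nat.add_comm 1 j)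

/-- State `C` scanning the leftmost of `3j+1` cells `1`, with left half-tape `L`. -/
def front (L : Stream' (Fin 2)) (j : ℕ) : Snapshot := (some 2, L, block 1 (3 * j + 1) blanks)

theorem Run.pass (j : ℕ) (L : Stream' (Fin 2)) :
    Run (6 * j + 7) (front (cons 0 L) j) (front L (j + 1)) := by
  have h₁ : Run 3 (front (cons 0 L) j) (some 5, cons 0 (cons 1 L), block 1 (3 * j) blanks) := by
    rw [front, block_succ]
    simpa only [cons_append_stream, nil_append_stream] using
      Run.of_windowRun (t := 3) (q := some 2) (l := [0]) (r := [1]) rfl L (block 1 (3 * j) blanks)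
  have h₂ := Run.sweep_right (q := some 5) rfl j (cons 0 (cons 1 L)) blanks
  have h₃ : Run 1 (some 5, block 0 (3 * j) (cons 0 (cons 1 L)), blanks)
      (some 2, block 0 (3 * j + 2) (cons 1 L), cons 0 blanks) := by
    have h := Run.of_windowRun (t := 1) (q := some 5) (l := []) (r := [0, 0]) rfl
      (block 0 (3 * j) (cons 0 (cons 1 L))) blanks
    simpa only [cons_append_stream, nil_append_stream, cons_blanks, block_cons,
      ← block_succ] using h
  have h₄ := Run.sweep_left (3 * j + 2) (cons 1 L) blanks
  have h₅ := Run.left (q := 2) (x := 0) rfl 1 L (block 1 (3 * j + 2) blanks)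
  rw [← block_succ, ← block_succ] at h₅
  exact ((((h₁.trans h₂).trans h₃).trans h₄).trans h₅).cast (by ring)

theorem Run.passes (m j : ℕ) (L : Stream' (Fin 2)) :
    Run (3 * m ^ 2 + 6 * j * m + 4 * m) (front (block 0 m L) j) (front L (j + m)) := by
  induction m generalizing j with
  | zero => exact Run.refl _
  | succ m ih =>
    rw [block_succ, show j + (m + 1) = j + 1 + m by ring]
    exact ((Run.pass j _).trans (ih (j + 1))).cast (by ring)

/-- The snapshot of the configuration `Cf n k`. -/
def snap (n k : ℕ) : Snapshot := front (cons 1 (block 0 n (cons 1 blanks))) k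

theorem Run.start : Run 47 (some 0, blanks, blanks) (snap 5 2) := by
  have h := Run.of_windowRun (t := 47) (q := some 0) (l := [0, 0, 0, 0])
    (r := [0, 0, 0, 0, 0, 0, 0, 0, 0, 0]) rfl blanks blanks
  simpa only [cons_append_stream, nil_append_stream, cons_blanks, snap, front, block_succ,
    block_zero] using h

theorem Run.snap_add_four (n k : ℕ) :
    Run (27 * k ^ 2 + 105 * k + 112) (snap (n + 4) k) (snap n (3 * k + 5)) := by
  unfold snap
  set X := block 0 n (cons 1 blanks) with hX
  have h₁ : Run 14 (front (cons 1 (block 0 (n + 4) (cons 1 blanks))) k)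
      (some 4, block 0 2 (cons 1 X), block 1 (3 * (k + 1)) blanks) := by
    have h := Run.of_windowRun (t := 14) (q := some 2) (l := [1, 0, 0, 0, 0]) (r := [1]) rfl X
      (block 1 (3 * k) blanks)
    simpa only [cons_append_stream, nil_append_stream, front, block_succ 0 (n + _), block_succ 0 n,
      block_succ 0 0, block_succ 0 1, block_zero, Nat.mul_succ, block_succ 1, ← hX] using h
  have h₂ := Run.sweep_right (q := some 4) rfl (k + 1) (block 0 2 (cons 1 X)) blanks
  have h₃ : Run 7 (some 4, block 0 (3 * (k + 1)) (block 0 2 (cons 1 X)), blanks)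
      (front (block 0 (3 * k + 4) (cons 1 X)) 1) := by
    have h := Run.of_windowRun (t := 7) (q := some 4) (l := [0]) (r := [0, 0, 0]) rfl
      (block 0 (3 * k + 4) (cons 1 X)) blanks
    rw [block_block, show 3 * (k + 1) + 2 = 3 * k + 4 + 1 by ring, block_succ]
    simpa only [cons_append_stream, nil_append_stream, cons_blanks, front, block_succ 1,
      block_zero] using h
  have h₄ := Run.passes (3 * k + 4) 1 (cons 1 X)
  rw [show 1 + (3 * k + 4) = 3 * k + 5 by ring] at h₄
  exact (((h₁.trans h₂).trans h₃).trans h₄).cast (by ring)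

theorem Run.tail_rebuild (j : ℕ) :
    Run (3 * j + 29) (some 1, cons 1 blanks, block 1 (3 * (j + 1)) blanks)
      (snap (3 * j + 2) 2) := by
  have h₁ := Run.sweep_right (q := some 1) rfl (j + 1) (cons 1 blanks) blanks
  have h₂ : Run 26 (some 1, block 0 (3 * j + 3) (cons 1 blanks), blanks) (snap (3 * j + 2) 2) := by
    have h := Run.of_windowRun (t := 26) (q := some 1) (l := [0]) (r := [0, 0, 0, 0, 0, 0, 0]) rfl
      (block 0 (3 * j + 2) (cons 1 blanks)) blanks
    rw [block_succ]
    simpa only [cons_append_stream, nil_append_stream, cons_blanks, snap, front, block_succ 1,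
      block_zero] using h
  exact (h₁.trans h₂).cast (by ring)

theorem Run.snap_one (k : ℕ) : Run (3 * k + 37) (snap 1 k) (snap (3 * k + 2) 2) := by
  have h : Run 8 (snap 1 k) (some 1, cons 1 blanks, block 1 (3 * (k + 1)) blanks) := by
    have h := Run.of_windowRun (t := 8) (q := some 2) (l := [1, 0, 1]) (r := [1]) rfl
      blanks (block 1 (3 * k) blanks)
    simpa only [cons_append_stream, nil_append_stream, snap, front, block_succ, block_zero,
      Nat.mul_succ] using h
  exact (h.trans (Run.tail_rebuild k)).cast (by ring)

theorem Run.snap_three (k : ℕ) : Run (3 * k + 57) (snap 3 k) (snap (3 * k + 8) 2) := by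
  have h : Run 22 (snap 3 k) (some 1, cons 1 blanks, block 1 (3 * (k + 2 + 1)) blanks) := by
    have h := Run.of_windowRun (t := 22) (q := some 2) (l := [1, 0, 0, 0, 1, 0, 0, 0, 0])
      (r := [1]) rfl blanks (block 1 (3 * k) blanks)
    simpa only [cons_append_stream, nil_append_stream, cons_blanks, snap, front, block_succ,
      block_zero, Nat.mul_succ] using h
  exact (h.trans (Run.tail_rebuild (k + 2))).cast (by ring)

theorem Run.snap_two (k : ℕ) : Run (12 * k + 44) (snap 2 k) (snap 4 (k + 2)) := by
  have h : Run 24 (snap 2 k) (front (block 0 2 (cons 1 (block 0 4 (cons 1 blanks)))) k) := by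
    have h := Run.of_windowRun (t := 24) (q := some 2) (l := [1, 0, 0, 1, 0, 0, 0, 0]) (r := [1])
      rfl blanks (block 1 (3 * k) blanks)
    simpa only [cons_append_stream, nil_append_stream, cons_blanks, snap, front, block_succ,
      block_zero] using h
  exact (h.trans (Run.passes 2 k _)).cast (by ring)

theorem Run.snap_zero (k : ℕ) :
    Run 2 (snap 0 k) (some 3, blanks, cons 1 (cons 0 (block 1 (3 * k + 1) blanks))) := by
  have h := Run.of_windowRun (t := 2) (q := some 2) (l := [1, 1]) (r := [1]) rfl
    blanks (block 1 (3 * k) blanks)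
  simpa only [cons_append_stream, nil_append_stream, snap, front, block_succ, block_zero] using h

/-- `m` iterations of `Run.snap_add_four`, with a closed form for the new parameter and a lower
bound for the number of steps. -/
theorem Run.exists_snap_add_four_mul (n m k : ℕ) :
    ∃ t k', Run t (snap (n + 4 * m) k) (snap n k') ∧ 2 * k' + 5 = 3 ^ m * (2 * k + 5) ∧
      27 * (2 * k' + 5) ^ 2 + 240 * (2 * k + 5) ≤
        32 * t + 27 * (2 * k + 5) ^ 2 + 240 * (2 * k' + 5) := by
  induction m generalizing k with
  | zero => exact ⟨0, k, Run.refl _, by simp, by omega⟩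
  | succ m ih =>
    obtain ⟨t, k', h, hk, ht⟩ := ih (3 * k + 5)
    refine ⟨_, k', (Run.snap_add_four (n + 4 * m) k).trans h, ?_, ?_⟩
    · rw [hk]
      ring
    · nlinarith

theorem haltsIn_succ {n k : ℕ} {T : Machine n k} {c : Cfg n k} {t : ℕ}
    (ht : ((step T)^[t] c).state ≠ none) (ht' : ((step T)^[t + 1] c).state = none) :
    HaltsIn T c (t + 1) := by
  refine ⟨ht', fun i hi h => ht ?_⟩
  have hfix : step T ((step T)^[i] c) = (step T)^[i] c := by
    simp only [step, h]
  rw [← Nat.sub_add_cancel (Nat.le_of_lt_succ hi), Function.iterate_add_apply,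
    Function.iterate_fixed hfix, h]

theorem Snapshot.toCfg_blanks : Snapshot.toCfg (some 0, blanks, blanks) 0 = init 6 2 := by
  simp only [Snapshot.toCfg, init, Cfg.mk.injEq]
  refine ⟨rfl, trivial, ?_⟩
  funext i
  split_ifs <;> rfl

theorem get_block_of_lt (x : Fin 2) (S : Stream' (Fin 2)) :
    ∀ {m d : ℕ}, d < m → (block x m S).get d = x
  | _ + 1, 0, _ => by rw [block_succ]; rfl
  | m + 1, d + 1, h => by
    rw [block_succ]
    exact get_block_of_lt x S (Nat.lt_of_succ_lt_succ h)

theorem get_block_of_le (x : Fin 2) (S : Stream' (Fin 2)) :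
    ∀ {m d : ℕ}, m ≤ d → (block x m S).get d = S.get (d - m)
  | 0, _, _ => rfl
  | m + 1, d + 1, h => by
    rw [block_succ, Nat.add_sub_add_right]
    exact get_block_of_le x S (Nat.le_of_succ_le_succ h)

theorem le_sigmaCount_toCfg (q : Option (Fin 6)) (m : ℕ) (p : ℤ) :
    m ≤ sigmaCount (Snapshot.toCfg (q, cons 1 blanks, cons 0 (block 1 m blanks)) p) := by
  set c := Snapshot.toCfg (q, cons 1 blanks, cons 0 (block 1 m blanks)) p with hc
  have hfin : {i : ℤ | c.tape i ≠ 0}.Finite := by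
    refine (Set.finite_Icc (p - 1) (p + m)).subset fun i hi => ?_
    by_contra hout
    refine hi ?_
    simp only [Set.mem_Icc, not_and_or, not_le] at hout
    simp only [hc, Snapshot.toCfg]
    rcases hout with h | h
    · obtain ⟨d, hd⟩ : ∃ d : ℕ, (p - 1 - i).toNat = d + 1 := ⟨(p - 2 - i).toNat, by omega⟩
      rw [if_neg (by omega), hd]
      rfl
    · obtain ⟨d, hd, hm⟩ : ∃ d : ℕ, (i - p).toNat = d + 1 ∧ m ≤ d :=
        ⟨(i - p - 1).toNat, by omega, by omega⟩
      rw [if_pos (by omega), hd]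
      exact get_block_of_le 1 blanks hm
  have hsub : Set.Icc (p + 1) (p + m) ⊆ {i : ℤ | c.tape i ≠ 0} := by
    rintro i ⟨h₁, h₂⟩
    obtain ⟨d, hd, hm⟩ : ∃ d : ℕ, (i - p).toNat = d + 1 ∧ d < m :=
      ⟨(i - p - 1).toNat, by omega, by omega⟩
    have hi : c.tape i = 1 := by
      simp only [hc, Snapshot.toCfg]
      rw [if_pos (by omega), hd]
      exact get_block_of_lt 1 blanks hm
    simp [hi]
  calc m = (Set.Icc (p + 1) (p + m)).ncard := by
        rw [← Finset.coe_Icc, Set.ncard_coe_finset, Int.card_Icc]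
        omega
    _ ≤ _ := Set.ncard_le_ncard hsub hfin

theorem halting_of_run {t k : ℕ} (h : Run t (some 0, blanks, blanks) (snap 0 k)) :
    HaltsIn M (init 6 2) (t + 3) ∧ 3 * k + 1 ≤ sigmaCount ((step M)^[t + 3] (init 6 2)) := by
  obtain ⟨p, hp⟩ := h.trans (Run.snap_zero k) 0
  obtain ⟨p', hp'⟩ := (h.trans (Run.snap_zero k)).trans (Run.right rfl _ _) 0
  rw [Snapshot.toCfg_blanks] at hp hp'
  refine ⟨haltsIn_succ ?_ ?_, ?_⟩
  · rw [hp]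
    exact Option.some_ne_none _
  · rw [hp']
    rfl
  · rw [hp']
    exact le_sigmaCount_toCfg _ _ _

set_option exponentiation.threshold 30000 in
theorem pow_three_lower_bound : 708 * 10 ^ 10563 ≤ 3 ^ 22143 * (2 * 2 + 5) := by
  norm_num

/-- Kropitz's machine halts from the all-blank tape, with more than `3.8 × 10^21132`
steps and more than `3.1 × 10^10566` non-blank cells on the final tape. -/
theorem kropitz_record :
    ∃ t : ℕ, HaltsIn M (init 6 2) t ∧ 38 * 10 ^ 21131 < t ∧
      31 * 10 ^ 10565 < sigmaCount ((step M)^[t] (init 6 2)) := by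
  obtain ⟨t₀, k₀, h₀, hk₀, -⟩ := Run.exists_snap_add_four_mul 1 1 2
  obtain ⟨t₁, k₁, h₁, hk₁, -⟩ := Run.exists_snap_add_four_mul 3 8 2
  obtain ⟨t₂, k, h₂, hk, ht₂⟩ := Run.exists_snap_add_four_mul 2 22143 2
  obtain rfl : k₀ = 11 := by omega
  obtain rfl : k₁ = 29522 := by omega
  have h₃ := (((((((Run.start.trans h₀).trans (Run.snap_one 11)).trans h₁).trans
    (Run.snap_three 29522)).trans h₂).trans (Run.snap_two k)).trans (Run.snap_add_four 0 (k + 2)))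
  obtain ⟨hhalt, hsigma⟩ := halting_of_run h₃
  obtain ⟨x, hx⟩ : ∃ x : ℕ, x = 10 ^ 10563 := ⟨_, rfl⟩
  have hpow : 708 * x ≤ 2 * k + 5 := by
    rw [hk, hx]
    exact pow_three_lower_bound
  have hxpos : 10 ^ 3 ≤ x := by
    rw [hx]
    exact Nat.pow_le_pow_right (by norm_num) (by norm_num)
  refine ⟨_, hhalt, ?_, ?_⟩
  · rw [show 21131 = 5 + 10563 * 2 from rfl, pow_add, pow_mul, ← hx]
    clear hx hk hhalt hsigma h₀ h₁ h₂ h₃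
    nlinarith
  · rw [show 10565 = 2 + 10563 from rfl, pow_add, ← hx]
    omega
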